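/- Suppose the star-connected occupied component C(0) containing the origin is finite and nonempty. Then every edge of G_C either is an edge of the outermost boundary cycle D_k of some occupied square S_k ∈ C(0), or is contained in the interior of some such cycle D_k. -/

import Mathlib

/-!
Common framework: tile ℝ² into closed unit squares indexed by `ℤ²`, with corners
forming a translate of `ℤ²` and the origin the centre of the square `S₀` (index `(0,0)`).
A cycle is identified with its edge set (a set of unordered pairs of corners);
its interior (resp. exterior) is the union of the bounded (resp. unbounded)
connected components of the complement of the closed curve it traces in the plane.
-/

/-- Corners of the grid squares, indexed by `ℤ²`. -/
abbrev GridV := ℤ × ℤ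

/-- Embedding of corners into the plane: the square of index `z` is
`[z₁ - 1/2, z₁ + 1/2] × [z₂ - 1/2, z₂ + 1/2]`, so the origin is the centre of `S₀`. -/
noncomputable def toPlane (v : GridV) : ℝ × ℝ := ((v.1 : ℝ) - 1 / 2, (v.2 : ℝ) - 1 / 2)

/-- The closed unit square of index `z`. -/
def squareSet (z : GridV) : Set (ℝ × ℝ) :=
  Set.Icc ((z.1 : ℝ) - 1 / 2, (z.2 : ℝ) - 1 / 2) ((z.1 : ℝ) + 1 / 2, (z.2 : ℝ) + 1 / 2)

/-- The four edges (unit segments) of the square of index `z`, as unordered pairs of corners. -/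
def squareEdges (z : GridV) : Set (Sym2 GridV) :=
  {s(z, z + (1, 0)), s(z + (1, 0), z + (1, 1)), s(z + (1, 1), z + (0, 1)), s(z + (0, 1), z)}

/-- Adjacency of corners in the full grid graph `G`: Euclidean distance one. -/
def GridAdj (u v : GridV) : Prop := |u.1 - v.1| + |u.2 - v.2| = 1

/-- A cycle in the full grid graph: a cyclic sequence `(v₀, …, v_{n-1}, v₀)` of
distinct corners with consecutive corners adjacent. -/
structure GridCycle where
  n : ℕ
  hn : 3 ≤ n
  f : ZMod n → GridV
  inj : Function.Injective f
  adj : ∀ i, GridAdj (f i) (f (i + 1))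

/-- The edge set of a grid cycle. -/
def GridCycle.edgeSet (C : GridCycle) : Set (Sym2 GridV) :=
  {e | ∃ i : ZMod C.n, e = s(C.f i, C.f (i + 1))}

/-- An edge set is (the edge set of) a cycle of the grid graph `G`.
We identify a cycle with its edge set. -/
def IsCycle (E : Set (Sym2 GridV)) : Prop := ∃ C : GridCycle, C.edgeSet = E

/-- A cycle of the subgraph of the grid graph with edge set `G`. -/
def IsCycleIn (G E : Set (Sym2 GridV)) : Prop := IsCycle E ∧ E ⊆ G

/-- The vertices incident to some edge of `E`. -/
def vertexSetOf (E : Set (Sym2 GridV)) : Set GridV := {v | ∃ e ∈ E, v ∈ e}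

/-- The closed segment in the plane realizing an edge. -/
noncomputable def edgeSeg : Sym2 GridV → Set (ℝ × ℝ) :=
  Sym2.lift ⟨fun a b => segment ℝ (toPlane a) (toPlane b), fun _ _ => segment_symm ℝ _ _⟩

/-- The closed curve in the plane traced by the edges of `E`. -/
noncomputable def carrierOf (E : Set (Sym2 GridV)) : Set (ℝ × ℝ) := ⋃ e ∈ E, edgeSeg e

/-- The interior of a cycle: the union of the bounded connected components of the
complement of its carrier curve. -/
noncomputable def interiorOf (E : Set (Sym2 GridV)) : Set (ℝ × ℝ) :=
  {p | p ∉ carrierOf E ∧ Bornology.IsBounded (connectedComponentIn (carrierOf E)ᶜ p)}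

/-- The exterior of a cycle: the union of the unbounded connected components of the
complement of its carrier curve. -/
noncomputable def exteriorOf (E : Set (Sym2 GridV)) : Set (ℝ × ℝ) :=
  {p | p ∉ carrierOf E ∧ ¬ Bornology.IsBounded (connectedComponentIn (carrierOf E)ᶜ p)}

/-- The set `A` is contained in the interior of the cycle `E` (points of the
curve itself being allowed, so that e.g. a square whose boundary edges lie on the
cycle counts as contained in the interior). -/
def inInterior (E : Set (Sym2 GridV)) (A : Set (ℝ × ℝ)) : Prop :=
  A ⊆ interiorOf E ∪ carrierOf E

/-- The set `A` lies in the exterior of the cycle `E` (points of the curve itself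
being allowed). -/
def inExterior (E : Set (Sym2 GridV)) (A : Set (ℝ × ℝ)) : Prop :=
  A ⊆ exteriorOf E ∪ carrierOf E

/-- Star adjacency: distinct squares sharing at least a corner. -/
def starAdj (z w : GridV) : Prop := z ≠ w ∧ |z.1 - w.1| ≤ 1 ∧ |z.2 - w.2| ≤ 1

/-- Plus adjacency: squares sharing an edge. -/
def plusAdj (z w : GridV) : Prop := |z.1 - w.1| + |z.2 - w.2| = 1

/-- The star-connected occupied component `C(0)` of the square `S₀` (of index `(0,0)`),
for the occupancy configuration `ω`; empty if `S₀` is vacant. -/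
def starComp (ω : GridV → Prop) : Set GridV :=
  {z | ω z ∧ Relation.ReflTransGen (fun a b => ω a ∧ ω b ∧ starAdj a b) (0, 0) z}

/-- The plus-connected occupied component `C⁺(0)` of the square `S₀`. -/
def plusComp (ω : GridV → Prop) : Set GridV :=
  {z | ω z ∧ Relation.ReflTransGen (fun a b => ω a ∧ ω b ∧ plusAdj a b) (0, 0) z}

/-- The edge set of the graph `G_C`: all edges of squares of `C(0)`. -/
def gcEdges (ω : GridV → Prop) : Set (Sym2 GridV) := ⋃ z ∈ starComp ω, squareEdges z

/-- The edge set of the graph `G⁺_C`: all edges of squares of `C⁺(0)`. -/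
def gpcEdges (ω : GridV → Prop) : Set (Sym2 GridV) := ⋃ z ∈ plusComp ω, squareEdges z

/-- `e` is an outermost boundary edge of the graph with edge set `G`: for every
cycle `E` in this graph, either `e` is an edge of `E` or `e` lies in the exterior of `E`. -/
def outermostBoundaryEdgeIn (G : Set (Sym2 GridV)) (e : Sym2 GridV) : Prop :=
  e ∈ G ∧ ∀ E, IsCycleIn G E → e ∈ E ∨ inExterior E (edgeSeg e)

/-- The subgraph spanned by the edge set `E` is connected: any two incident vertices
are joined by a walk using only edges of `E`. -/
def EdgeSetConnected (E : Set (Sym2 GridV)) : Prop :=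
  ∀ u v, u ∈ vertexSetOf E → v ∈ vertexSetOf E →
    ∃ p : List GridV, p.head? = some u ∧ p.getLast? = some v ∧
      List.Chain' (fun a b => s(a, b) ∈ E) p

/-- `D` is the outermost boundary cycle `D_k` of the square of index `z` of the star
component `C(0)`: (a) the square lies in the interior of `D`; (b) every edge of `D` is a
boundary edge adjacent to an occupied square of `C(0)` in the interior of `D` and to a
vacant square in the exterior of `D`; (c) every cycle of `G_C` containing the square in
its interior has all its edges on `D` or in the interior of `D`. -/
def isOutermostCycleOf (ω : GridV → Prop) (z : GridV) (D : Set (Sym2 GridV)) : Prop :=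
  IsCycleIn (gcEdges ω) D ∧
  inInterior D (squareSet z) ∧
  (∀ e ∈ D,
    (∃ w ∈ starComp ω, e ∈ squareEdges w ∧ inInterior D (squareSet w)) ∧
    (∃ w, ¬ ω w ∧ e ∈ squareEdges w ∧ inExterior D (squareSet w))) ∧
  (∀ C, IsCycleIn (gcEdges ω) C → inInterior C (squareSet z) →
    ∀ e ∈ C, e ∈ D ∨ inInterior D (edgeSeg e))

/-- The list of edges traversed by a walk given as a list of vertices. -/
def walkEdges (p : List GridV) : List (Sym2 GridV) :=
  List.zipWith (fun a b => s(a, b)) p p.tail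

/-- The edges separating a square of `A` from a square outside `A`. -/
def cellBoundary (A : Set GridV) : Set (Sym2 GridV) :=
  {e | ∃ a ∈ A, ∃ b ∉ A, e ∈ squareEdges a ∧ e ∈ squareEdges b}

theorem horizontal_mem_squareEdges {x y : ℤ} {w : GridV} :
    s((x, y), (x + 1, y)) ∈ squareEdges w ↔ w = (x, y) ∨ w = (x, y - 1) := by
  obtain ⟨a, b⟩ := w
  simp only [squareEdges, Set.mem_insert_iff, Set.mem_singleton_iff, Sym2.eq_iff, Prod.mk_add_mk,
    Prod.mk.injEq]
  omega

theorem vertical_mem_squareEdges {x y : ℤ} {w : GridV} :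
    s((x, y), (x, y + 1)) ∈ squareEdges w ↔ w = (x, y) ∨ w = (x - 1, y) := by
  obtain ⟨a, b⟩ := w
  simp only [squareEdges, Set.mem_insert_iff, Set.mem_singleton_iff, Sym2.eq_iff, Prod.mk_add_mk,
    Prod.mk.injEq]
  omega

theorem exists_of_mem_squareEdges {e : Sym2 GridV} {w : GridV} (h : e ∈ squareEdges w) :
    ∃ x y : ℤ, e = s((x, y), (x + 1, y)) ∨ e = s((x, y), (x, y + 1)) := by
  obtain ⟨a, b⟩ := w
  simp only [squareEdges, Set.mem_insert_iff, Set.mem_singleton_iff, Prod.mk_add_mk,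
    add_zero] at h
  rcases h with rfl | rfl | rfl | rfl
  · exact ⟨a, b, Or.inl rfl⟩
  · exact ⟨a + 1, b, Or.inr rfl⟩
  · exact ⟨a, b + 1, Or.inl Sym2.eq_swap⟩
  · exact ⟨a, b, Or.inr Sym2.eq_swap⟩

theorem eq_or_eq_of_mem_squareEdges {e : Sym2 GridV} {a b c : GridV} (hab : a ≠ b)
    (ha : e ∈ squareEdges a) (hb : e ∈ squareEdges b) (hc : e ∈ squareEdges c) :
    c = a ∨ c = b := by
  obtain ⟨x, y, rfl | rfl⟩ := exists_of_mem_squareEdges ha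
  · rw [horizontal_mem_squareEdges] at ha hb hc
    grind
  · rw [vertical_mem_squareEdges] at ha hb hc
    grind

theorem mem_cellBoundary_iff {e : Sym2 GridV} {a b : GridV} (hab : a ≠ b)
    (ha : e ∈ squareEdges a) (hb : e ∈ squareEdges b) (A : Set GridV) :
    e ∈ cellBoundary A ↔ ¬(a ∈ A ↔ b ∈ A) := by
  constructor
  · rintro ⟨c, hc, d, hd, hec, hed⟩
    have h1 := eq_or_eq_of_mem_squareEdges hab ha hb hec
    have h2 := eq_or_eq_of_mem_squareEdges hab ha hb hed
    grind
  · intro h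
    by_cases haA : a ∈ A
    · exact ⟨a, haA, b, by tauto, ha, hb⟩
    · exact ⟨b, by tauto, a, haA, hb, ha⟩

theorem horizontal_mem_cellBoundary {x y : ℤ} {A : Set GridV} :
    s((x, y), (x + 1, y)) ∈ cellBoundary A ↔ ¬((x, y) ∈ A ↔ (x, y - 1) ∈ A) :=
  mem_cellBoundary_iff (by simp; omega) (horizontal_mem_squareEdges.2 (Or.inl rfl))
    (horizontal_mem_squareEdges.2 (Or.inr rfl)) A

theorem vertical_mem_cellBoundary {x y : ℤ} {A : Set GridV} :
    s((x, y), (x, y + 1)) ∈ cellBoundary A ↔ ¬((x, y) ∈ A ↔ (x - 1, y) ∈ A) :=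
  mem_cellBoundary_iff (by simp; omega) (vertical_mem_squareEdges.2 (Or.inl rfl))
    (vertical_mem_squareEdges.2 (Or.inr rfl)) A

theorem gridAdj_iff {u v : GridV} :
    GridAdj u v ↔ v = (u.1 + 1, u.2) ∨ v = (u.1 - 1, u.2) ∨ v = (u.1, u.2 + 1) ∨
      v = (u.1, u.2 - 1) := by
  obtain ⟨a, b⟩ := u
  obtain ⟨c, d⟩ := v
  simp only [GridAdj, Prod.mk.injEq]
  grind

theorem gridAdj_of_mem_cellBoundary {A : Set GridV} {u v : GridV}
    (h : s(u, v) ∈ cellBoundary A) : GridAdj u v := by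
  obtain ⟨a, -, b, -, ha, -⟩ := h
  obtain ⟨x, y, h | h⟩ := exists_of_mem_squareEdges ha <;>
  · rw [Sym2.eq_iff] at h
    rcases h with ⟨rfl, rfl⟩ | ⟨rfl, rfl⟩ <;> simp [gridAdj_iff]

/-- The boundary of a set of squares has no vertex of degree one. -/
theorem exists_ne_mem_cellBoundary {A : Set GridV} {u v : GridV}
    (h : s(u, v) ∈ cellBoundary A) : ∃ w, w ≠ u ∧ s(v, w) ∈ cellBoundary A := by
  have hadj : GridAdj v u := gridAdj_of_mem_cellBoundary (Sym2.eq_swap ▸ h)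
  obtain ⟨x, y⟩ := v
  rw [Sym2.eq_swap] at h
  have e1 := @horizontal_mem_cellBoundary x y A
  have e2 := @horizontal_mem_cellBoundary (x - 1) y A
  have e3 := @vertical_mem_cellBoundary x y A
  have e4 := @vertical_mem_cellBoundary x (y - 1) A
  rw [Sym2.eq_swap, sub_add_cancel] at e2 e4
  by_contra! hcon
  have c1 := hcon (x + 1, y)
  have c2 := hcon (x - 1, y)
  have c3 := hcon (x, y + 1)
  have c4 := hcon (x, y - 1)
  rw [e1, not_not] at c1
  rw [e2, not_not] at c2
  rw [e3, not_not] at c3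
  rw [e4, not_not] at c4
  clear hcon
  rw [gridAdj_iff] at hadj
  rcases hadj with rfl | rfl | rfl | rfl
  · exact e1.1 h ((c3 (by simp)).trans ((c2 (by simp; omega)).trans (c4 (by simp)).symm))
  · exact e2.1 h ((c3 (by simp)).symm.trans ((c1 (by simp; omega)).trans (c4 (by simp))))
  · exact e3.1 h ((c1 (by simp)).trans ((c4 (by simp; omega)).trans (c2 (by simp)).symm))
  · exact e4.1 h ((c1 (by simp)).symm.trans ((c3 (by simp; omega)).trans (c2 (by simp))))

theorem eq_empty_of_cellBoundary_eq_empty {A : Set GridV} (hA : A.Finite)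
    (h : cellBoundary A = ∅) : A = ∅ := by
  by_contra hne
  obtain ⟨a, ha, hmax⟩ := hA.exists_maximalFor Prod.fst A (Set.nonempty_iff_ne_empty.2 hne)
  have hv := @vertical_mem_cellBoundary (a.1 + 1) a.2 A
  rw [h, add_sub_cancel_right] at hv
  have h2 : (a.1 + 1, a.2) ∈ A := by
    simp only [Set.mem_empty_iff_false, false_iff, not_not] at hv
    exact hv.2 ha
  have := hmax h2 (by simp)
  simp at this

theorem cellBoundary_injOn : Set.InjOn cellBoundary {A : Set GridV | A.Finite} := by
  intro A hA B hB h
  rw [← symmDiff_eq_bot]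
  refine eq_empty_of_cellBoundary_eq_empty (hA.symmDiff hB) ?_
  ext e
  simp only [Set.mem_empty_iff_false, iff_false]
  rintro ⟨a, ha, b, hb, hea, heb⟩
  have hab : a ≠ b := fun h => hb (h ▸ ha)
  have h1 := mem_cellBoundary_iff hab hea heb A
  have h2 := mem_cellBoundary_iff hab hea heb B
  rw [h] at h1
  simp only [Set.mem_symmDiff] at ha hb
  tauto

/-- A nonempty finite boundary contains a cycle. -/
theorem exists_isCycle_subset_cellBoundary {A : Set GridV} (hfin : (cellBoundary A).Finite)
    (hne : (cellBoundary A).Nonempty) : ∃ E ⊆ cellBoundary A, IsCycle E := by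
  obtain ⟨e, he⟩ := hne
  induction e with | _ u v
  choose! next hnext using fun (p : GridV × GridV) (h : s(p.1, p.2) ∈ cellBoundary A) =>
    exists_ne_mem_cellBoundary h
  let walk : ℕ → GridV × GridV := fun n => (fun p => (p.2, next p))^[n] (u, v)
  have walk_succ : ∀ n, walk (n + 1) = ((walk n).2, next (walk n)) := fun n =>
    Function.iterate_succ_apply' _ _ _
  have walk_mem : ∀ n, s((walk n).1, (walk n).2) ∈ cellBoundary A := by
    intro n
    induction n with
    | zero => exact he
    | succ n ih => rw [walk_succ]; exact (hnext _ ih).2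
  let g : ℕ → GridV := fun n => (walk n).1
  have g_mem : ∀ n, s(g n, g (n + 1)) ∈ cellBoundary A := by
    intro n
    have := walk_mem n
    simpa only [g, walk_succ] using this
  have g_ne : ∀ n, g (n + 2) ≠ g n := by
    intro n
    have := (hnext _ (walk_mem n)).1
    simpa only [g, walk_succ] using this
  have g_adj : ∀ n, GridAdj (g n) (g (n + 1)) := fun n => gridAdj_of_mem_cellBoundary (g_mem n)
  have g_not_inj : ∃ d, 0 < d ∧ ∃ i, g i = g (i + d) := by
    have hV : {w | ∃ e ∈ cellBoundary A, w ∈ e}.Finite := by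
      have : {w | ∃ e ∈ cellBoundary A, w ∈ e} = ⋃ e ∈ cellBoundary A, {w | w ∈ e} := by
        ext; simp
      rw [this]
      refine hfin.biUnion fun e _ => ?_
      induction e with | _ a b
      simp only [Sym2.mem_iff]
      exact (Set.finite_singleton b).insert a
    have hmaps : Set.MapsTo g Set.univ {w | ∃ e ∈ cellBoundary A, w ∈ e} :=
      fun n _ => ⟨_, g_mem n, Sym2.mem_mk_left _ _⟩
    obtain ⟨i, -, j, -, hij, h⟩ := Set.infinite_univ.exists_ne_map_eq_of_mapsTo hmaps hV
    rcases lt_or_gt_of_ne hij with hlt | hlt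
    · exact ⟨j - i, by omega, i, by rw [h]; congr 1; omega⟩
    · exact ⟨i - j, by omega, j, by rw [← h]; congr 1; omega⟩
  classical
  obtain ⟨hd, i, hi⟩ := Nat.find_spec g_not_inj
  have hmin : ∀ m, 0 < m → m < Nat.find g_not_inj → ∀ j, g j ≠ g (j + m) := by
    intro m hm hlt j hj
    exact Nat.find_min g_not_inj hlt ⟨hm, j, hj⟩
  generalize Nat.find g_not_inj = d at *
  have hd3 : 3 ≤ d := by
    by_contra hlt
    obtain rfl | rfl : d = 1 ∨ d = 2 := by omega
    · have := g_adj i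
      rw [← hi] at this
      simp [GridAdj] at this
    · exact g_ne i hi.symm
  have : NeZero d := ⟨by omega⟩
  have hsucc : ∀ k : ZMod d, g (i + (k + 1).val) = g (i + k.val + 1) := by
    intro k
    have : Fact (1 < d) := ⟨by omega⟩
    have hk := k.val_lt
    rcases Nat.lt_or_ge (k.val + 1) d with h | h
    · rw [ZMod.val_add_of_lt (by rw [ZMod.val_one]; exact h), ZMod.val_one, add_assoc]
    · have h0 : (k + 1).val = 0 := by
        rw [ZMod.val_add, ZMod.val_one, show k.val + 1 = d by omega, Nat.mod_self]
      rw [h0, add_assoc, show k.val + 1 = d by omega, add_zero, hi]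
  let C : GridCycle := ⟨d, hd3, fun k => g (i + k.val), ?_, ?_⟩
  · refine ⟨C.edgeSet, ?_, C, rfl⟩
    rintro _ ⟨k, rfl⟩
    simp only [C, hsucc]
    exact g_mem _
  · intro k l hkl
    have hk := k.val_lt
    have hl := l.val_lt
    apply ZMod.val_injective
    by_contra hne
    rcases lt_or_gt_of_ne hne with h | h
    · refine hmin (l.val - k.val) (by omega) (by omega) (i + k.val) ?_
      simp only at hkl
      rw [hkl]; congr 1; omega
    · refine hmin (k.val - l.val) (by omega) (by omega) (i + l.val) ?_
      simp only at hkl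
      rw [← hkl]; congr 1; omega
  · intro k
    simp only [hsucc]
    exact g_adj _

theorem GridCycle.f_add_one_ne_f_sub_one (C : GridCycle) (i : ZMod C.n) :
    C.f (i + 1) ≠ C.f (i - 1) := by
  intro h
  have h2 : ((2 : ℕ) : ZMod C.n) = 0 := by
    have := C.inj h
    push_cast
    linear_combination this
  rw [ZMod.natCast_eq_zero_iff] at h2
  have := Nat.le_of_dvd (by norm_num) h2
  have := C.hn
  omega

theorem GridCycle.mem_edgeSet_iff (C : GridCycle) (i : ZMod C.n) (w : GridV) :
    s(C.f i, w) ∈ C.edgeSet ↔ w = C.f (i + 1) ∨ w = C.f (i - 1) := by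
  constructor
  · rintro ⟨j, hj⟩
    rw [Sym2.eq_iff] at hj
    rcases hj with ⟨h1, rfl⟩ | ⟨h1, rfl⟩
    · rw [C.inj h1]; exact Or.inl rfl
    · rw [C.inj h1, add_sub_cancel_right]; exact Or.inr rfl
  · rintro (rfl | rfl)
    · exact ⟨i, rfl⟩
    · exact ⟨i - 1, by rw [sub_add_cancel, Sym2.eq_swap]⟩

theorem GridCycle.edge_shape (C : GridCycle) {e : Sym2 GridV} (he : e ∈ C.edgeSet) :
    ∃ x y : ℤ, e = s((x, y), (x + 1, y)) ∨ e = s((x, y), (x, y + 1)) := by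
  obtain ⟨i, rfl⟩ := he
  have h := C.adj i
  generalize C.f i = u at h
  generalize C.f (i + 1) = v at h
  rw [gridAdj_iff] at h
  obtain ⟨x, y⟩ := u
  rcases h with rfl | rfl | rfl | rfl
  · exact ⟨x, y, Or.inl rfl⟩
  · exact ⟨x - 1, y, Or.inl (by rw [Sym2.eq_swap, sub_add_cancel])⟩
  · exact ⟨x, y, Or.inr rfl⟩
  · exact ⟨x, y - 1, Or.inr (by rw [Sym2.eq_swap, sub_add_cancel])⟩

open Classical in
/-- Every vertex has even degree in a cycle. -/
theorem GridCycle.even_degree (C : GridCycle) (x y : ℤ) :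
    (if s((x, y), (x + 1, y)) ∈ C.edgeSet then (1 : ZMod 2) else 0) +
      (if s((x - 1, y), (x, y)) ∈ C.edgeSet then 1 else 0) +
      (if s((x, y), (x, y + 1)) ∈ C.edgeSet then 1 else 0) +
      (if s((x, y - 1), (x, y)) ∈ C.edgeSet then 1 else 0) = 0 := by
  rw [Sym2.eq_swap (a := (x - 1, y)), Sym2.eq_swap (a := (x, y - 1))]
  by_cases hv : ∃ i, C.f i = (x, y)
  · obtain ⟨i, hi⟩ := hv
    rw [← hi]
    simp only [C.mem_edgeSet_iff]
    have h1 : GridAdj (x, y) (C.f (i + 1)) := hi ▸ C.adj i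
    have h2 : GridAdj (x, y) (C.f (i - 1)) := by
      have := C.adj (i - 1)
      rw [sub_add_cancel, hi] at this
      simpa only [GridAdj, abs_sub_comm] using this
    have h12 := C.f_add_one_ne_f_sub_one i
    rw [gridAdj_iff] at h1 h2
    generalize C.f (i + 1) = a at *
    generalize C.f (i - 1) = b at *
    have n1 : x + 1 ≠ x - 1 := by omega
    have n2 : y + 1 ≠ y - 1 := by omega
    have n3 : x ≠ x - 1 := by omega
    have n4 : y ≠ y - 1 := by omega
    rcases h1 with rfl | rfl | rfl | rfl <;> rcases h2 with rfl | rfl | rfl | rfl <;>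
      first
      | exact absurd rfl h12
      | simp [n1, n1.symm, n2, n2.symm, n3, n3.symm, n4, n4.symm]
        try decide
  · have h : ∀ w, s((x, y), w) ∉ C.edgeSet := by
      rintro w ⟨i, hi⟩
      rw [Sym2.eq_iff] at hi
      rcases hi with ⟨h, -⟩ | ⟨h, -⟩ <;> exact hv ⟨_, h.symm⟩
    simp [h]

/-- A finitely supported even edge weight modulo two on the grid is the coboundary of a
finitely supported face weight. -/
theorem exists_face_potential (H V : ℤ → ℤ → ZMod 2) (R : ℤ)
    (hH : ∀ x y, H x y ≠ 0 → |x| < R ∧ |y| < R) (hV : ∀ x y, V x y ≠ 0 → |x| < R ∧ |y| < R)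
    (hev : ∀ x y, H x y + H (x - 1) y + V x y + V x (y - 1) = 0) :
    ∃ N : ℤ → ℤ → ZMod 2, (∀ x y, N x y + N (x - 1) y = V x y) ∧
      (∀ x y, N x y + N x (y - 1) = H x y) ∧
      ∀ x y, N x y ≠ 0 → |x| ≤ R ∧ |y| ≤ R := by
  have hH0 : ∀ x y, R ≤ |x| ∨ R ≤ |y| → H x y = 0 := by
    intro x y h
    by_contra hne
    have := hH x y hne
    omega
  have hV0 : ∀ x y, R ≤ |x| ∨ R ≤ |y| → V x y = 0 := by
    intro x y h
    by_contra hne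
    have := hV x y hne
    omega
  let N : ℤ → ℤ → ZMod 2 := fun x y => ∑ k ∈ Finset.Ioo x R, V k y
  have hNR : ∀ x y, R ≤ x → N x y = 0 := by
    intro x y h
    simp only [N]
    rw [Finset.Ioo_eq_empty (by omega), Finset.sum_empty]
  have hNV : ∀ x y, N (x - 1) y = V x y + N x y := by
    intro x y
    rcases lt_or_ge x R with h | h
    · simp only [N]
      rw [show Finset.Ioo (x - 1) R = insert x (Finset.Ioo x R) by
          ext k; simp only [Finset.mem_Ioo, Finset.mem_insert]; omega,
        Finset.sum_insert (by simp)]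
    · rw [hNR x y h, hV0 x y (Or.inl (h.trans (le_abs_self x))), add_zero]
      refine Finset.sum_eq_zero fun k hk => ?_
      rw [Finset.mem_Ioo] at hk
      omega
  have two : ∀ a : ZMod 2, a + a = 0 := by decide
  have hNH : ∀ y x, N x y + N x (y - 1) = H x y := by
    intro y x
    have hbase : ∀ x, R ≤ x → N x y + N x (y - 1) = H x y := by
      intro x h
      rw [hNR x y h, hNR x _ h, hH0 x y (Or.inl (h.trans (le_abs_self x))), add_zero]
    rcases le_total R x with h | h
    · exact hbase x h
    · induction x, h using Int.leInductionDown with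
      | base => exact hbase R le_rfl
      | pred x hx ih =>
        rw [hNV x y, hNV x (y - 1)]
        linear_combination ih - hev x y + two (H x y) + two (V x y) + two (V x (y - 1))
  have hNy : ∀ x y, R ≤ |y| → N x y = 0 := by
    intro x y h
    exact Finset.sum_eq_zero fun k _ => hV0 k y (Or.inr h)
  refine ⟨N, fun x y => ?_, fun x y => hNH y x, fun x y hne => ?_⟩
  · rw [hNV]
    linear_combination two (N x y)
  · have hy : |y| < R := by
      by_contra h
      exact hne (hNy x y (by omega))
    refine ⟨?_, hy.le⟩
    by_contra! hx
    rcases lt_or_ge x 0 with h0 | h0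
    · apply hne
      have hstep : ∀ y, N x y = N x (y - 1) := by
        intro y
        have h1 := hNH y x
        rw [hH0 x y (Or.inl hx.le)] at h1
        linear_combination h1 - two (N x (y - 1))
      have hall : ∀ k : ℕ, N x y = N x (y - k) := by
        intro k
        induction k with
        | zero => simp
        | succ k ih => rw [ih, hstep]; push_cast; congr 1; ring
      rw [hall (2 * R.toNat)]
      apply hNy
      have := abs_lt.1 hy
      rw [abs_of_nonpos (by omega)]
      omega
    · rw [abs_of_nonneg h0] at hx
      exact hne (hNR x y hx.le)

/-- Every cycle is the boundary of a finite set of squares. -/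
theorem GridCycle.exists_cellBoundary_eq (C : GridCycle) :
    ∃ A : Set GridV, A.Finite ∧ cellBoundary A = C.edgeSet := by
  classical
  obtain ⟨R, hR⟩ : ∃ R : ℤ, ∀ i, |(C.f i).1| < R ∧ |(C.f i).2| < R := by
    have : NeZero C.n := ⟨by have := C.hn; omega⟩
    obtain ⟨R, hR⟩ := (Set.finite_range fun i => max |(C.f i).1| |(C.f i).2|).bddAbove
    refine ⟨R + 1, fun i => ?_⟩
    have := max_le_iff.1 (hR ⟨i, rfl⟩)
    omega
  have hbd : ∀ u v, s(u, v) ∈ C.edgeSet → |u.1| < R ∧ |u.2| < R := by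
    rintro u v ⟨i, hi⟩
    rw [Sym2.eq_iff] at hi
    rcases hi with ⟨rfl, -⟩ | ⟨rfl, -⟩ <;> exact hR _
  obtain ⟨N, hNV, hNH, hN⟩ := exists_face_potential
    (fun x y => if s((x, y), (x + 1, y)) ∈ C.edgeSet then 1 else 0)
    (fun x y => if s((x, y), (x, y + 1)) ∈ C.edgeSet then 1 else 0) R
    (fun x y h => hbd (x, y) _ (not_not.1 fun hc => h (if_neg hc)))
    (fun x y h => hbd (x, y) _ (not_not.1 fun hc => h (if_neg hc)))
    (fun x y => by simpa using C.even_degree x y)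
  have key : ∀ a b : ZMod 2, ∀ p : Prop, a + b = (if p then 1 else 0) →
      (¬(a = 1 ↔ b = 1) ↔ p) := by
    intro a b p h
    have : (a + b = 1) ↔ p := by by_cases hp : p <;> simp [h, hp]
    rw [← this]
    clear this h
    revert a b
    decide
  have mem_iff : ∀ x y, N x y ≠ 0 ↔ N x y = 1 := by
    intro x y
    generalize N x y = a
    revert a
    decide
  refine ⟨{z | N z.1 z.2 = 1}, ?_, ?_⟩
  · refine ((Set.finite_Icc (-R) R).prod (Set.finite_Icc (-R) R)).subset fun z hz => ?_
    have := hN z.1 z.2 ((mem_iff _ _).2 hz)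
    simp only [abs_le] at this
    exact this
  · have hh : ∀ x y : ℤ, s((x, y), (x + 1, y)) ∈ cellBoundary {z | N z.1 z.2 = 1} ↔
        s((x, y), (x + 1, y)) ∈ C.edgeSet := fun x y =>
      horizontal_mem_cellBoundary.trans (key _ _ _ (hNH x y))
    have hv : ∀ x y : ℤ, s((x, y), (x, y + 1)) ∈ cellBoundary {z | N z.1 z.2 = 1} ↔
        s((x, y), (x, y + 1)) ∈ C.edgeSet := fun x y =>
      vertical_mem_cellBoundary.trans (key _ _ _ (hNV x y))
    ext e
    constructor
    · intro he
      obtain ⟨a, -, b, -, ha, -⟩ := id he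
      obtain ⟨x, y, rfl | rfl⟩ := exists_of_mem_squareEdges ha
      exacts [(hh x y).1 he, (hv x y).1 he]
    · intro he
      obtain ⟨x, y, rfl | rfl⟩ := C.edge_shape he
      exacts [(hh x y).2 he, (hv x y).2 he]

/-- A boundary contained in a cycle is empty or the whole cycle. -/
theorem GridCycle.cellBoundary_eq_of_subset (C : GridCycle) {T : Set GridV}
    (h : cellBoundary T ⊆ C.edgeSet) : cellBoundary T = ∅ ∨ cellBoundary T = C.edgeSet := by
  rcases Set.eq_empty_or_nonempty (cellBoundary T) with h0 | ⟨e, he⟩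
  · exact Or.inl h0
  refine Or.inr (h.antisymm ?_)
  obtain ⟨i, rfl⟩ := id (h he)
  have step : ∀ j, s(C.f j, C.f (j + 1)) ∈ cellBoundary T →
      s(C.f (j + 1), C.f (j + 1 + 1)) ∈ cellBoundary T := by
    intro j hj
    obtain ⟨w, hw, hmem⟩ := exists_ne_mem_cellBoundary hj
    rcases (C.mem_edgeSet_iff _ _).1 (h hmem) with rfl | rfl
    · exact hmem
    · rw [add_sub_cancel_right] at hw
      exact absurd rfl hw
  have hall : ∀ k : ℕ, s(C.f (i + k), C.f (i + k + 1)) ∈ cellBoundary T := by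
    intro k
    induction k with
    | zero => simpa using he
    | succ k ih =>
      have := step _ ih
      push_cast
      rwa [← add_assoc]
  rintro _ ⟨j, rfl⟩
  have : NeZero C.n := ⟨by have := C.hn; omega⟩
  have := hall (j - i).val
  rwa [ZMod.natCast_zmod_val, add_sub_cancel] at this

theorem finite_cellBoundary {A : Set GridV} (hA : A.Finite) : (cellBoundary A).Finite := by
  refine (hA.biUnion (t := squareEdges) fun a _ => ?_).subset ?_
  · rw [squareEdges]
    exact Set.toFinite _
  · rintro e ⟨a, ha, -, -, hea, -⟩
    exact Set.mem_biUnion ha hea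

/-- The boundary of a finite set of squares is a cycle if it is minimal among boundaries. -/
theorem isCycle_cellBoundary {A : Set GridV} (hA : A.Finite) (hne : A.Nonempty)
    (hmin : ∀ T : Set GridV, T.Finite → cellBoundary T ⊆ cellBoundary A → T = ∅ ∨ T = A) :
    IsCycle (cellBoundary A) := by
  have hb : (cellBoundary A).Nonempty := by
    rw [Set.nonempty_iff_ne_empty] at hne ⊢
    exact fun h => hne (eq_empty_of_cellBoundary_eq_empty hA h)
  obtain ⟨_, hE, C, rfl⟩ := exists_isCycle_subset_cellBoundary (finite_cellBoundary hA) hb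
  obtain ⟨T, hT, hTC⟩ := C.exists_cellBoundary_eq
  rcases hmin T hT (hTC ▸ hE) with rfl | rfl
  · have h0 : s(C.f 0, C.f (0 + 1)) ∈ cellBoundary ∅ := hTC ▸ ⟨0, rfl⟩
    obtain ⟨a, ha, -⟩ := h0
    exact absurd ha (Set.notMem_empty a)
  · exact ⟨C, hTC.symm⟩

theorem squareEdges_nonempty (w : GridV) : (squareEdges w).Nonempty :=
  ⟨_, Set.mem_insert _ _⟩

theorem cellBoundary_subset_iff {T A : Set GridV} :
    cellBoundary T ⊆ cellBoundary A ↔ ∀ a b, (squareEdges a ∩ squareEdges b).Nonempty →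
      (a ∈ A ↔ b ∈ A) → (a ∈ T ↔ b ∈ T) := by
  constructor
  · rintro h a b ⟨e, hea, heb⟩ hab
    by_cases hne : a = b
    · rw [hne]
    have := @h e
    rw [mem_cellBoundary_iff hne hea heb, mem_cellBoundary_iff hne hea heb] at this
    tauto
  · rintro h e ⟨a, ha, b, hb, hea, heb⟩
    rw [mem_cellBoundary_iff (fun hab : a = b => hb (hab ▸ ha)) hea heb]
    intro hab
    exact hb ((h a b ⟨e, hea, heb⟩ hab).1 ha)

/-- A set of squares is connected through shared edges. -/
def CellConnected (A : Set GridV) : Prop :=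
  ∀ T ⊆ A, cellBoundary T ⊆ cellBoundary A → T = ∅ ∨ T = A

theorem cellConnected_singleton (z : GridV) : CellConnected {z} :=
  fun _ hT _ => Set.subset_singleton_iff_eq.1 hT

theorem CellConnected.inter_eq {A T U : Set GridV} (hA : CellConnected A)
    (hU : A ⊆ U) (hT : cellBoundary T ⊆ cellBoundary U) : T ∩ A = ∅ ∨ A ⊆ T := by
  rw [cellBoundary_subset_iff] at hT
  refine (hA (T ∩ A) Set.inter_subset_right ?_).imp_right Set.inter_eq_right.1
  rw [cellBoundary_subset_iff]
  intro a b h hab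
  have h1 := hT a b h
  have h2 := @hU a
  have h3 := @hU b
  simp only [Set.mem_inter_iff]
  tauto

theorem CellConnected.union {A B : Set GridV} (hA : CellConnected A) (hB : CellConnected B)
    {a b : GridV} (ha : a ∈ A) (hb : b ∈ B)
    (hab : (squareEdges a ∩ squareEdges b).Nonempty) : CellConnected (A ∪ B) := by
  intro T hTs hT
  have h := cellBoundary_subset_iff.1 hT a b hab (iff_of_true (Or.inl ha) (Or.inr hb))
  rcases hA.inter_eq Set.subset_union_left hT with h1 | h1 <;>
    rcases hB.inter_eq Set.subset_union_right hT with h2 | h2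
  · left
    rw [← Set.inter_eq_left.2 hTs, Set.inter_union_distrib_left, h1, h2, Set.union_empty]
  · exact absurd ⟨h.2 (h2 hb), ha⟩ (Set.eq_empty_iff_forall_notMem.1 h1 a)
  · exact absurd ⟨h.1 (h1 ha), hb⟩ (Set.eq_empty_iff_forall_notMem.1 h2 b)
  · exact Or.inr (hTs.antisymm (Set.union_subset h1 h2))

theorem cellBoundary_union_subset (A B : Set GridV) :
    cellBoundary (A ∪ B) ⊆ cellBoundary A ∪ cellBoundary B := by
  rintro e ⟨a, ha | ha, b, hb, hea, heb⟩
  · exact Or.inl ⟨a, ha, b, fun h => hb (Or.inl h), hea, heb⟩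
  · exact Or.inr ⟨a, ha, b, fun h => hb (Or.inr h), hea, heb⟩

/-- Filling holes of a connected set of squares keeps it connected. -/
theorem CellConnected.union_of_cellBoundary_subset {K B : Set GridV} (hK : CellConnected K)
    (hB : B.Finite) (hdisj : Disjoint B K) (hsub : cellBoundary B ⊆ cellBoundary K) :
    CellConnected (K ∪ B) := by
  have main : ∀ R ⊆ B, cellBoundary R ⊆ cellBoundary (K ∪ B) → R = ∅ := by
    intro R hRB hR
    refine eq_empty_of_cellBoundary_eq_empty (hB.subset hRB) ?_
    rw [Set.eq_empty_iff_forall_notMem]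
    rintro e ⟨a, ha, b, hb, hea, heb⟩
    have haK := Set.disjoint_left.1 hdisj (hRB ha)
    have h1 := cellBoundary_subset_iff.1 hR a b ⟨e, hea, heb⟩
    have h2 := cellBoundary_subset_iff.1 hsub a b ⟨e, hea, heb⟩
    have h3 := @hRB a ha
    simp only [Set.mem_union] at h1
    tauto
  intro T hTs hT
  rcases hK.inter_eq Set.subset_union_left hT with h1 | h1
  · refine Or.inl (main T (fun t ht => (hTs ht).resolve_left fun h => ?_) hT)
    exact Set.eq_empty_iff_forall_notMem.1 h1 t ⟨ht, h⟩
  · refine Or.inr (hTs.antisymm ?_)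
    rw [← Set.sdiff_eq_empty]
    refine main _ (fun t ht => ht.1.resolve_left fun h => ht.2 (h1 h)) ?_
    rw [cellBoundary_subset_iff] at hT ⊢
    intro a b hab h
    have := hT a b hab h
    simp only [Set.mem_sdiff]
    tauto

/-- A maximal connected finite set of squares among those with boundary in `G` is bounded by
a cycle. -/
theorem isCycle_cellBoundary_of_maximal {G : Set (Sym2 GridV)} {K : Set GridV} (hfin : K.Finite)
    (hne : K.Nonempty) (hK : CellConnected K) (hG : cellBoundary K ⊆ G)
    (hmax : ∀ L, K ⊆ L → L.Finite → CellConnected L → cellBoundary L ⊆ G → L ⊆ K) :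
    IsCycle (cellBoundary K) := by
  refine isCycle_cellBoundary hfin hne fun T hT hsub => ?_
  have hsub' : cellBoundary (T \ K) ⊆ cellBoundary K := by
    rw [cellBoundary_subset_iff] at hsub ⊢
    intro a b hab h
    have := hsub a b hab h
    simp only [Set.mem_sdiff]
    tauto
  have hconn := hK.union_of_cellBoundary_subset hT.sdiff Set.disjoint_sdiff_left hsub'
  have hle := hmax _ Set.subset_union_left (hfin.union hT.sdiff) hconn
    ((cellBoundary_union_subset _ _).trans (Set.union_subset hG (hsub'.trans hG)))
  have hTK : T ⊆ K := fun t ht => by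
    by_contra h
    exact h (hle (Or.inr ⟨ht, h⟩))
  exact hK T hTK hsub

/-- Among the connected finite sets of squares with boundary in a finite `G` and containing a
given square, there is a maximal one; it contains all the others and is bounded by a cycle. -/
theorem exists_maximal_cellConnected {G : Set (Sym2 GridV)} (hG : G.Finite) {z : GridV}
    (hz : squareEdges z ⊆ G) :
    ∃ K : Set GridV, K.Finite ∧ z ∈ K ∧ cellBoundary K ⊆ G ∧ IsCycle (cellBoundary K) ∧
      ∀ L : Set GridV, L.Finite → CellConnected L → cellBoundary L ⊆ G →
        ∀ a ∈ K, ∀ b ∈ L, (squareEdges a ∩ squareEdges b).Nonempty → L ⊆ K := by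
  let F : Set (Set GridV) := {A | A.Finite ∧ z ∈ A ∧ CellConnected A ∧ cellBoundary A ⊆ G}
  have hF : F.Finite :=
    Set.Finite.of_injOn (f := cellBoundary) (t := 𝒫 G) (fun A hA => hA.2.2.2)
      (cellBoundary_injOn.mono fun A hA => hA.1) hG.finite_subsets
  have hne : F.Nonempty := by
    refine ⟨{z}, Set.finite_singleton z, rfl, cellConnected_singleton z, ?_⟩
    rintro e ⟨a, rfl, -, -, he, -⟩
    exact hz he
  obtain ⟨K, ⟨hfin, hzK, hconn, hKG⟩, hmax⟩ := hF.exists_maximal hne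
  refine ⟨K, hfin, hzK, hKG, isCycle_cellBoundary_of_maximal hfin ⟨z, hzK⟩ hconn hKG
    fun L hKL h1 h2 h3 => hmax ⟨h1, hKL hzK, h2, h3⟩ hKL, ?_⟩
  intro L hL hLc hLG a ha b hb hab
  refine Set.subset_union_right.trans (hmax (y := K ∪ L) ⟨hfin.union hL, Or.inl hzK,
    hconn.union hLc ha hb hab, ?_⟩ Set.subset_union_left)
  exact (cellBoundary_union_subset _ _).trans (Set.union_subset hKG hLG)

theorem mem_squareSet_iff {p : ℝ × ℝ} {w : GridV} :
    p ∈ squareSet w ↔ ((w.1 : ℝ) - 1 / 2 ≤ p.1 ∧ p.1 ≤ w.1 + 1 / 2) ∧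
      ((w.2 : ℝ) - 1 / 2 ≤ p.2 ∧ p.2 ≤ w.2 + 1 / 2) := by
  simp only [squareSet, Set.mem_Icc, Prod.le_def]
  tauto

theorem mem_edgeSeg_horizontal {p : ℝ × ℝ} {x y : ℤ} :
    p ∈ edgeSeg s((x, y), (x + 1, y)) ↔
      ((x : ℝ) - 1 / 2 ≤ p.1 ∧ p.1 ≤ x + 1 / 2) ∧ p.2 = y - 1 / 2 := by
  obtain ⟨a, b⟩ := p
  have h : (x : ℝ) + 1 - 1 / 2 = x + 1 / 2 := by ring
  simp only [edgeSeg, Sym2.lift_mk, toPlane]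
  rw [← Prod.image_mk_segment_left, segment_eq_Icc (by push_cast; linarith)]
  push_cast
  rw [h]
  simp [eq_comm]

theorem mem_edgeSeg_vertical {p : ℝ × ℝ} {x y : ℤ} :
    p ∈ edgeSeg s((x, y), (x, y + 1)) ↔
      p.1 = x - 1 / 2 ∧ ((y : ℝ) - 1 / 2 ≤ p.2 ∧ p.2 ≤ y + 1 / 2) := by
  obtain ⟨a, b⟩ := p
  have h : (y : ℝ) + 1 - 1 / 2 = y + 1 / 2 := by ring
  simp only [edgeSeg, Sym2.lift_mk, toPlane]
  rw [← Prod.image_mk_segment_right, segment_eq_Icc (by push_cast; linarith)]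
  push_cast
  rw [h]
  simp [eq_comm, and_comm]

theorem edgeSeg_subset_squareSet {e : Sym2 GridV} {w : GridV} (h : e ∈ squareEdges w) :
    edgeSeg e ⊆ squareSet w := by
  intro p hp
  rw [mem_squareSet_iff]
  obtain ⟨x, y, rfl | rfl⟩ := exists_of_mem_squareEdges h
  · rw [mem_edgeSeg_horizontal] at hp
    rw [horizontal_mem_squareEdges] at h
    obtain ⟨⟨h1, h2⟩, h3⟩ := hp
    rcases h with rfl | rfl <;> push_cast <;> refine ⟨⟨?_, ?_⟩, ?_, ?_⟩ <;> linarith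
  · rw [mem_edgeSeg_vertical] at hp
    rw [vertical_mem_squareEdges] at h
    obtain ⟨h3, h1, h2⟩ := hp
    rcases h with rfl | rfl <;> push_cast <;> refine ⟨⟨?_, ?_⟩, ?_, ?_⟩ <;> linarith

theorem exists_mem_squareSet (p : ℝ × ℝ) : ∃ w, p ∈ squareSet w := by
  refine ⟨(⌊p.1 + 1 / 2⌋, ⌊p.2 + 1 / 2⌋), mem_squareSet_iff.2 ?_⟩
  have h1 := Int.floor_le (p.1 + 1 / 2)
  have h2 := Int.lt_floor_add_one (p.1 + 1 / 2)
  have h3 := Int.floor_le (p.2 + 1 / 2)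
  have h4 := Int.lt_floor_add_one (p.2 + 1 / 2)
  refine ⟨⟨?_, ?_⟩, ?_, ?_⟩ <;> linarith

theorem isCompact_squareSet (w : GridV) : IsCompact (squareSet w) := isCompact_Icc

theorem locallyFinite_squareSet : LocallyFinite squareSet := by
  intro p
  refine ⟨Metric.ball p 1, Metric.ball_mem_nhds p one_pos, ?_⟩
  refine ((Set.finite_Icc (⌊p.1⌋ - 3) (⌊p.1⌋ + 3)).prod
    (Set.finite_Icc (⌊p.2⌋ - 3) (⌊p.2⌋ + 3))).subset ?_
  rintro w ⟨q, hq, hqp⟩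
  rw [mem_squareSet_iff] at hq
  rw [Metric.mem_ball, Prod.dist_eq, max_lt_iff, Real.dist_eq, Real.dist_eq, abs_lt, abs_lt]
    at hqp
  have h1 := Int.floor_le p.1
  have h2 := Int.lt_floor_add_one p.1
  have h3 := Int.floor_le p.2
  have h4 := Int.lt_floor_add_one p.2
  obtain ⟨⟨a1, a2⟩, a3, a4⟩ := hq
  obtain ⟨⟨b1, b2⟩, b3, b4⟩ := hqp
  refine ⟨⟨?_, ?_⟩, ?_, ?_⟩ <;>
  · rify
    linarith

theorem isClosed_biUnion_squareSet (A : Set GridV) : IsClosed (⋃ w ∈ A, squareSet w) := by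
  rw [Set.biUnion_eq_iUnion]
  exact (locallyFinite_squareSet.comp_injective Subtype.val_injective).isClosed_iUnion
    fun w => (isCompact_squareSet w).isClosed

theorem mem_carrierOf_cellBoundary {A : Set GridV} {p : ℝ × ℝ} {a b : GridV} (ha : a ∈ A)
    (hb : b ∉ A) (hpa : p ∈ squareSet a) (hpb : p ∈ squareSet b) :
    p ∈ carrierOf (cellBoundary A) := by
  have hor : ∀ x y, ¬((x, y) ∈ A ↔ (x, y - 1) ∈ A) → p ∈ squareSet (x, y) →
      p ∈ squareSet (x, y - 1) → p ∈ carrierOf (cellBoundary A) := by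
    intro x y h h1 h2
    refine Set.mem_biUnion (horizontal_mem_cellBoundary.2 h) (mem_edgeSeg_horizontal.2 ?_)
    rw [mem_squareSet_iff] at h1 h2
    push_cast at h1 h2
    exact ⟨h1.1, by linarith [h1.2.1, h2.2.2]⟩
  have ver : ∀ x y, ¬((x, y) ∈ A ↔ (x - 1, y) ∈ A) → p ∈ squareSet (x, y) →
      p ∈ squareSet (x - 1, y) → p ∈ carrierOf (cellBoundary A) := by
    intro x y h h1 h2
    refine Set.mem_biUnion (vertical_mem_cellBoundary.2 h) (mem_edgeSeg_vertical.2 ?_)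
    rw [mem_squareSet_iff] at h1 h2
    push_cast at h1 h2
    exact ⟨by linarith [h1.1.1, h2.1.2], h1.2⟩
  obtain ⟨x, y⟩ := a
  obtain ⟨x', y'⟩ := b
  have hpc : p ∈ squareSet (x, y') := by
    rw [mem_squareSet_iff] at *
    exact ⟨hpa.1, hpb.2⟩
  have close : ∀ m n : ℤ, ∀ t : ℝ, (m : ℝ) - 1 / 2 ≤ t → t ≤ m + 1 / 2 → (n : ℝ) - 1 / 2 ≤ t →
      t ≤ n + 1 / 2 → m = n ∨ n = m - 1 ∨ m = n - 1 := by
    intro m n t h1 h2 h3 h4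
    have h5 : m ≤ n + 1 := by rify; linarith
    have h6 : n ≤ m + 1 := by rify; linarith
    omega
  have hpa' := mem_squareSet_iff.1 hpa
  have hpb' := mem_squareSet_iff.1 hpb
  by_cases hc : (x, y') ∈ A
  · rcases close x x' p.1 hpa'.1.1 hpa'.1.2 hpb'.1.1 hpb'.1.2 with rfl | rfl | rfl
    · exact absurd hc hb
    · exact ver x y' (by tauto) hpc hpb
    · exact ver x' y' (by tauto) hpb hpc
  · rcases close y y' p.2 hpa'.2.1 hpa'.2.2 hpb'.2.1 hpb'.2.2 with rfl | rfl | rfl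
    · exact absurd ha hc
    · exact hor x y (by tauto) hpa hpc
    · exact hor x y' (by tauto) hpc hpa

/-- Squares of a finite set lie inside its boundary. -/
theorem inInterior_of_mem {A : Set GridV} (hA : A.Finite) {w : GridV} (hw : w ∈ A) :
    inInterior (cellBoundary A) (squareSet w) := by
  intro p hp
  by_cases hpc : p ∈ carrierOf (cellBoundary A)
  · exact Or.inr hpc
  refine Or.inl ⟨hpc, ?_⟩
  have hbdd : Bornology.IsBounded (⋃ w ∈ A, squareSet w) :=
    (hA.isCompact_biUnion fun w _ => isCompact_squareSet w).isBounded
  refine hbdd.subset fun q hq => ?_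
  by_contra hqA
  obtain ⟨w', hw'⟩ := exists_mem_squareSet q
  have hw'A : w' ∉ A := fun h => hqA (Set.mem_biUnion h hw')
  obtain ⟨r, hr, hrA, hrB⟩ := isPreconnected_closed_iff.1
    (isPreconnected_connectedComponentIn (F := (carrierOf (cellBoundary A))ᶜ) (x := p))
    _ _ (isClosed_biUnion_squareSet A) (isClosed_biUnion_squareSet Aᶜ)
    (fun r _ => by
      obtain ⟨v, hv⟩ := exists_mem_squareSet r
      by_cases hvA : v ∈ A
      · exact Or.inl (Set.mem_biUnion hvA hv)
      · exact Or.inr (Set.mem_biUnion (s := Aᶜ) hvA hv))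
    ⟨p, mem_connectedComponentIn hpc, Set.mem_biUnion hw hp⟩
    ⟨q, hq, Set.mem_biUnion (s := Aᶜ) hw'A hw'⟩
  obtain ⟨a, ha, hra⟩ := Set.mem_iUnion₂.1 hrA
  obtain ⟨b, hb, hrb⟩ := Set.mem_iUnion₂.1 hrB
  exact connectedComponentIn_subset _ _ hr (mem_carrierOf_cellBoundary ha hb hra hrb)

/-- The centre of a square. -/
def squareCenter (w : GridV) : ℝ × ℝ := (w.1, w.2)

theorem squareCenter_mem (w : GridV) : squareCenter w ∈ squareSet w := by
  rw [mem_squareSet_iff]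
  refine ⟨⟨?_, ?_⟩, ?_, ?_⟩ <;> simp only [squareCenter] <;> linarith

theorem notMem_carrierOf_of_abs_lt {A : Set GridV} {q : ℝ × ℝ} {w : GridV}
    (h1 : |q.1 - w.1| < 1 / 2) (h2 : |q.2 - w.2| < 1 / 2) :
    q ∉ carrierOf (cellBoundary A) := by
  have key : ∀ m n : ℤ, |((n : ℝ) - 1 / 2) - m| < 1 / 2 → False := by
    intro m n h
    rw [abs_lt] at h
    have h3 : m < n := by rify; linarith
    have h4 : n < m + 1 := by rify; linarith
    omega
  intro hq
  obtain ⟨e, ⟨a, -, b, -, ha, -⟩, hqe⟩ := Set.mem_iUnion₂.1 hq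
  obtain ⟨x, y, rfl | rfl⟩ := exists_of_mem_squareEdges ha
  · rw [mem_edgeSeg_horizontal] at hqe
    exact key _ _ (hqe.2 ▸ h2)
  · rw [mem_edgeSeg_vertical] at hqe
    exact key _ _ (hqe.1 ▸ h1)

theorem squareCenter_notMem_carrierOf (A : Set GridV) (w : GridV) :
    squareCenter w ∉ carrierOf (cellBoundary A) :=
  notMem_carrierOf_of_abs_lt (w := w) (by simp [squareCenter]) (by simp [squareCenter])

theorem segment_squareCenter_subset {A : Set GridV} {p : ℝ × ℝ} {w : GridV}
    (hp : p ∈ squareSet w) (hpc : p ∉ carrierOf (cellBoundary A)) :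
    segment ℝ p (squareCenter w) ⊆ (carrierOf (cellBoundary A))ᶜ := by
  rintro q ⟨a, b, ha, hb, hab, rfl⟩
  rcases hb.eq_or_lt with rfl | hb
  · obtain rfl : a = 1 := by linarith
    simpa using hpc
  have key : ∀ s t : ℝ, t - 1 / 2 ≤ s → s ≤ t + 1 / 2 → |a * s + b * t - t| < 1 / 2 := by
    intro s t h1 h2
    have h3 : |s - t| ≤ 1 / 2 := abs_le.2 ⟨by linarith, by linarith⟩
    rw [show a * s + b * t - t = a * (s - t) by rw [← eq_sub_iff_add_eq'] at hab; rw [hab]; ring,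
      abs_mul, abs_of_nonneg ha]
    nlinarith
  rw [mem_squareSet_iff] at hp
  exact notMem_carrierOf_of_abs_lt (w := w) (key _ _ hp.1.1 hp.1.2) (key _ _ hp.2.1 hp.2.2)

theorem squareCenter_mem_connectedComponentIn {A : Set GridV} {p : ℝ × ℝ} {w : GridV}
    (hp : p ∈ squareSet w) (hpc : p ∉ carrierOf (cellBoundary A)) :
    squareCenter w ∈ connectedComponentIn (carrierOf (cellBoundary A))ᶜ p :=
  (convex_segment p _).isPreconnected.subset_connectedComponentIn (left_mem_segment ℝ _ _)
    (segment_squareCenter_subset hp hpc) (right_mem_segment ℝ _ _)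

/-- Each edge has a point which lies on no other edge. -/
theorem exists_mem_edgeSeg_notMem_carrierOf {A : Set GridV} {e : Sym2 GridV} {w : GridV}
    (hw : e ∈ squareEdges w) (he : e ∉ cellBoundary A) :
    ∃ p ∈ edgeSeg e, p ∉ carrierOf (cellBoundary A) := by
  have key1 : ∀ m n : ℤ, (m : ℝ) = n - 1 / 2 → False := by
    intro m n h
    have : 2 * m = 2 * n - 1 := by rify; linarith
    omega
  have key2 : ∀ m n : ℤ, (n : ℝ) - 1 / 2 ≤ m → (m : ℝ) ≤ n + 1 / 2 → m = n := by
    intro m n h1 h2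
    have h3 : m < n + 1 := by rify; linarith
    have h4 : n < m + 1 := by rify; linarith
    omega
  have key3 : ∀ m n : ℤ, (m : ℝ) - 1 / 2 = n - 1 / 2 → m = n := by
    intro m n h
    exact_mod_cast sub_left_injective h
  obtain ⟨x, y, rfl | rfl⟩ := exists_of_mem_squareEdges hw
  · refine ⟨((x : ℝ), (y : ℝ) - 1 / 2), mem_edgeSeg_horizontal.2
      ⟨⟨by simp, by simp⟩, rfl⟩, fun hq => ?_⟩
    obtain ⟨e, he', hqe⟩ := Set.mem_iUnion₂.1 hq
    obtain ⟨a, -, b, -, ha, -⟩ := id he'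
    obtain ⟨x', y', rfl | rfl⟩ := exists_of_mem_squareEdges ha
    · rw [mem_edgeSeg_horizontal] at hqe
      obtain rfl := key2 _ _ hqe.1.1 hqe.1.2
      obtain rfl := key3 _ _ hqe.2
      exact he he'
    · rw [mem_edgeSeg_vertical] at hqe
      exact key1 _ _ hqe.1
  · refine ⟨((x : ℝ) - 1 / 2, (y : ℝ)), mem_edgeSeg_vertical.2
      ⟨rfl, by simp, by simp⟩, fun hq => ?_⟩
    obtain ⟨e, he', hqe⟩ := Set.mem_iUnion₂.1 hq
    obtain ⟨a, -, b, -, ha, -⟩ := id he'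
    obtain ⟨x', y', rfl | rfl⟩ := exists_of_mem_squareEdges ha
    · rw [mem_edgeSeg_horizontal] at hqe
      exact key1 _ _ hqe.2
    · rw [mem_edgeSeg_vertical] at hqe
      obtain rfl := key2 _ _ hqe.2.1 hqe.2.2
      obtain rfl := key3 _ _ hqe.1
      exact he he'

theorem finite_squareCenter_mem {S : Set (ℝ × ℝ)} (hS : Bornology.IsBounded S) :
    {w | squareCenter w ∈ S}.Finite := by
  have := locallyFinite_squareSet.finite_nonempty_inter_compact hS.isCompact_closure
  exact this.subset fun w hw => ⟨_, squareCenter_mem w, subset_closure hw⟩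

/-- A square outside a finite set bounded by a cycle lies in the exterior of that cycle. -/
theorem not_isBounded_connectedComponentIn {A : Set GridV} (hA : A.Finite)
    (hcyc : IsCycle (cellBoundary A)) {w : GridV} (hw : w ∉ A) {p : ℝ × ℝ}
    (hp : p ∈ squareSet w) (hpc : p ∉ carrierOf (cellBoundary A)) :
    ¬Bornology.IsBounded (connectedComponentIn (carrierOf (cellBoundary A))ᶜ p) := by
  intro hbdd
  set S := connectedComponentIn (carrierOf (cellBoundary A))ᶜ p with hS
  set T : Set GridV := {v | squareCenter v ∈ S} with hT
  have hTfin : T.Finite := finite_squareCenter_mem hbdd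
  have hwT : w ∈ T := squareCenter_mem_connectedComponentIn hp hpc
  have hsub : cellBoundary T ⊆ cellBoundary A := by
    rintro e ⟨a, ha, b, hb, hea, heb⟩
    by_contra he
    obtain ⟨m, hme, hmc⟩ := exists_mem_edgeSeg_notMem_carrierOf hea he
    have h1 := squareCenter_mem_connectedComponentIn (edgeSeg_subset_squareSet hea hme) hmc
    have h2 := squareCenter_mem_connectedComponentIn (edgeSeg_subset_squareSet heb hme) hmc
    have h3 : S = connectedComponentIn (carrierOf (cellBoundary A))ᶜ m :=
      (connectedComponentIn_eq ha).trans (connectedComponentIn_eq h1).symm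
    exact hb (show squareCenter b ∈ S from h3 ▸ h2)
  obtain ⟨C, hC⟩ := hcyc
  rcases C.cellBoundary_eq_of_subset (hC ▸ hsub) with h | h
  · exact Set.eq_empty_iff_forall_notMem.1 (eq_empty_of_cellBoundary_eq_empty hTfin h) w hwT
  · exact hw (cellBoundary_injOn hTfin hA (h.trans hC) ▸ hwT)

theorem inExterior_of_notMem {A : Set GridV} (hA : A.Finite) (hcyc : IsCycle (cellBoundary A))
    {w : GridV} (hw : w ∉ A) : inExterior (cellBoundary A) (squareSet w) := by
  intro p hp
  by_cases hpc : p ∈ carrierOf (cellBoundary A)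
  · exact Or.inr hpc
  · exact Or.inl ⟨hpc, not_isBounded_connectedComponentIn hA hcyc hw hp hpc⟩

theorem mem_of_inInterior {A : Set GridV} (hA : A.Finite) (hcyc : IsCycle (cellBoundary A))
    {w : GridV} (h : inInterior (cellBoundary A) (squareSet w)) : w ∈ A := by
  by_contra hw
  have hc := squareCenter_notMem_carrierOf A w
  have := (h (squareCenter_mem w)).resolve_right hc
  exact not_isBounded_connectedComponentIn hA hcyc hw (squareCenter_mem w) hc this.2

/-- A set of squares bounded by a cycle is connected. -/
theorem cellConnected_of_isCycle {A : Set GridV} (hA : A.Finite)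
    (hcyc : IsCycle (cellBoundary A)) : CellConnected A := by
  intro T hTA hsub
  obtain ⟨C, hC⟩ := hcyc
  refine (C.cellBoundary_eq_of_subset (hC ▸ hsub)).imp
    (eq_empty_of_cellBoundary_eq_empty (hA.subset hTA)) fun h => ?_
  exact cellBoundary_injOn (hA.subset hTA) hA (h.trans hC)

theorem starAdj_of_mem_squareEdges {e : Sym2 GridV} {a b : GridV} (hab : a ≠ b)
    (ha : e ∈ squareEdges a) (hb : e ∈ squareEdges b) : starAdj a b := by
  refine ⟨hab, ?_⟩
  obtain ⟨x, y, rfl | rfl⟩ := exists_of_mem_squareEdges ha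
  · rw [horizontal_mem_squareEdges] at ha hb
    rcases ha with rfl | rfl <;> rcases hb with rfl | rfl <;> simp
  · rw [vertical_mem_squareEdges] at ha hb
    rcases ha with rfl | rfl <;> rcases hb with rfl | rfl <;> simp

theorem finite_gcEdges {ω : GridV → Prop} (hfin : (starComp ω).Finite) :
    (gcEdges ω).Finite :=
  hfin.biUnion fun w _ => by rw [squareEdges]; exact Set.toFinite _

/-- Every square of a finite star component has an outermost boundary cycle. -/
theorem exists_isOutermostCycleOf {ω : GridV → Prop} (hfin : (starComp ω).Finite) {z : GridV}
    (hz : z ∈ starComp ω) : ∃ D, isOutermostCycleOf ω z D := by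
  have hsub : ∀ w ∈ starComp ω, squareEdges w ⊆ gcEdges ω :=
    fun w hw => Set.subset_biUnion_of_mem hw
  obtain ⟨K, hK, hzK, hKG, hcyc, hmax⟩ :=
    exists_maximal_cellConnected (finite_gcEdges hfin) (hsub z hz)
  refine ⟨cellBoundary K, ⟨hcyc, hKG⟩, inInterior_of_mem hK hzK, fun e he => ?_, ?_⟩
  · obtain ⟨a, ha, b, hb, hea, heb⟩ := id he
    have hab : a ≠ b := fun h => hb (h ▸ ha)
    have hbC : b ∉ starComp ω := by
      intro hbC
      refine hb (hmax {b} (Set.finite_singleton b) (cellConnected_singleton b) ?_ a ha b rfl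
        ⟨e, hea, heb⟩ rfl)
      rintro e' ⟨_, rfl, -, -, he', -⟩
      exact hsub _ hbC he'
    obtain ⟨w, hw, hew⟩ := Set.mem_iUnion₂.1 (hKG he)
    have haC : a ∈ starComp ω := by
      rcases eq_or_eq_of_mem_squareEdges hab hea heb hew with rfl | rfl
      · exact hw
      · exact absurd hw hbC
    refine ⟨⟨a, haC, hea, inInterior_of_mem hK ha⟩, b, fun hωb => hbC ⟨hωb, ?_⟩, heb,
      inExterior_of_notMem hK hcyc hb⟩
    exact haC.2.tail ⟨haC.1, hωb, starAdj_of_mem_squareEdges hab hea heb⟩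
  · rintro E ⟨⟨C, rfl⟩, hCG⟩ hzC e he
    obtain ⟨A, hA, hAC⟩ := C.exists_cellBoundary_eq
    rw [← hAC] at hCG hzC he
    have hAcyc : IsCycle (cellBoundary A) := ⟨C, hAC.symm⟩
    have hAK : A ⊆ K := hmax A hA (cellConnected_of_isCycle hA hAcyc) hCG z hzK z
      (mem_of_inInterior hA hAcyc hzC) (by rw [Set.inter_self]; exact squareEdges_nonempty z)
    obtain ⟨a, ha, -, -, hea, -⟩ := he
    exact Or.inr ((edgeSeg_subset_squareSet hea).trans (inInterior_of_mem hK (hAK ha)))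

/-- If `C(0)` is finite and nonempty, every edge of `G_C` either is an
edge of the outermost boundary cycle `D_k` of some occupied square `S_k ∈ C(0)`, or is
contained in the interior of some such cycle `D_k`. -/
theorem every_edge_on_or_inside_outermost_cycle (ω : GridV → Prop)
    (hfin : (starComp ω).Finite) (hne : (starComp ω).Nonempty) :
    ∀ e ∈ gcEdges ω, ∃ z ∈ starComp ω, ∃ D, isOutermostCycleOf ω z D ∧
      (e ∈ D ∨ inInterior D (edgeSeg e)) := by
  intro e he
  obtain ⟨z, hz, hez⟩ := Set.mem_iUnion₂.1 he
  obtain ⟨D, hD⟩ := exists_isOutermostCycleOf hfin hz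
  exact ⟨z, hz, D, hD, Or.inr ((edgeSeg_subset_squareSet hez).trans hD.2.1)⟩
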